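/- Fix integers r ≥ 1 and m ≥ 1 and a real number t. For each composition q = (q_1,…,q_p) of positive integers with 1 ≤ p ≤ r and q_1 + ⋯ + q_p = m, define R_q on the domain {(x_1,…,x_r) ∈ ℝ^r : t < x_1 < ⋯ < x_r} by R_q(x) = Σ_{1≤s_1<⋯<s_p≤r} ∏_{j=1}^p (x_{s_j} − t)^{−q_j}. If complex coefficients (λ_q), indexed by all such compositions q of total m and length at most r, satisfy Σ_q λ_q · R_q = 0 at every point of the domain, then λ_q = 0 for every q. -/

import Mathlib

open scoped BigOperators

/-- Compositions of `m` into `p` positive parts, as functions `Fin p → ℕ`. -/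
def comps (m p : ℕ) : Finset (Fin p → ℕ) :=
  (Fintype.piFinset fun _ : Fin p => Finset.Icc 1 m).filter fun q => ∑ j, q j = m

/-- `R_q(x) = Σ_{1≤s₁<⋯<s_p≤r} ∏_{j=1}^p (x_{s_j} − t)^{−q_j}`, as a ℂ-valued
function of `x : Fin r → ℝ`; the inner sum ranges over strictly increasing
`p`-tuples of indices in `{1,…,r}`. -/
noncomputable def Rfun (r : ℕ) (t : ℝ) {p : ℕ} (q : Fin p → ℕ)
    (x : Fin r → ℝ) : ℂ :=
  ∑ s ∈ Finset.univ.filter (fun s : Fin p → Fin r => ∀ i j, i < j → s i < s j),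
    ∏ j : Fin p, ((((x (s j) - t : ℝ) : ℂ)) ^ (q j))⁻¹

/-- The exponent vector of the monomial `∏ j, X (s j) ^ q j`. -/
noncomputable def compExponent {r p : ℕ} (q : Fin p → ℕ) (s : Fin p → Fin r) : Fin r →₀ ℕ :=
  ∑ j, Finsupp.single (s j) (q j)

lemma compExponent_apply_of_injective {r p : ℕ} (q : Fin p → ℕ) {s : Fin p → Fin r}
    (hs : Function.Injective s) (j : Fin p) : compExponent q s (s j) = q j := by
  simp [compExponent, Finsupp.finsetSum_apply, Finsupp.single_apply, hs.eq_iff]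

lemma compExponent_support {r p : ℕ} {q : Fin p → ℕ} {s : Fin p → Fin r}
    (hq : ∀ j, 0 < q j) (hs : Function.Injective s) :
    ((compExponent q s).support : Set (Fin r)) = Set.range s := by
  ext i
  simp only [Finset.mem_coe, Finsupp.mem_support_iff, Set.mem_range]
  constructor
  · intro hi
    by_contra! hne
    exact hi (by simp [compExponent, Finsupp.finsetSum_apply, hne])
  · rintro ⟨j, rfl⟩
    rw [compExponent_apply_of_injective q hs]
    exact (hq j).ne'

lemma length_eq_of_compExponent_eq {r p p' : ℕ} {q : Fin p → ℕ} {q' : Fin p' → ℕ}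
    {s : Fin p → Fin r} {s' : Fin p' → Fin r} (hq : ∀ j, 0 < q j) (hq' : ∀ j, 0 < q' j)
    (hs : StrictMono s) (hs' : StrictMono s') (h : compExponent q s = compExponent q' s') :
    p = p' := by
  have hrange : Set.range s = Set.range s' := by
    rw [← compExponent_support hq hs.injective, h, compExponent_support hq' hs'.injective]
  simpa [Set.ncard_range_of_injective, hs.injective, hs'.injective] using
    congrArg Set.ncard hrange

lemma eq_of_compExponent_eq {r p : ℕ} {q q' : Fin p → ℕ}
    {s s' : Fin p → Fin r} (hq : ∀ j, 0 < q j) (hq' : ∀ j, 0 < q' j)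
    (hs : StrictMono s) (hs' : StrictMono s') (h : compExponent q s = compExponent q' s') :
    q = q' ∧ s = s' := by
  have hrange : Set.range s = Set.range s' := by
    rw [← compExponent_support hq hs.injective, h, compExponent_support hq' hs'.injective]
  obtain rfl := (hs.range_inj hs').1 hrange
  refine ⟨funext fun j => ?_, rfl⟩
  rw [← compExponent_apply_of_injective q hs.injective, h,
    compExponent_apply_of_injective q' hs.injective]

/-- The monomial quasisymmetric polynomial in `r` variables attached to `q`. -/
noncomputable def quasiMonomial (r : ℕ) {p : ℕ} (q : Fin p → ℕ) : MvPolynomial (Fin r) ℂ :=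
  ∑ s ∈ Finset.univ.filter (fun s : Fin p → Fin r => ∀ i j, i < j → s i < s j),
    MvPolynomial.monomial (compExponent q s) 1

lemma eval_quasiMonomial (r : ℕ) {p : ℕ} (q : Fin p → ℕ) (y : Fin r → ℂ) :
    MvPolynomial.eval y (quasiMonomial r q) =
      ∑ s ∈ Finset.univ.filter (fun s : Fin p → Fin r => ∀ i j, i < j → s i < s j),
        ∏ j, y (s j) ^ q j := by
  simp [quasiMonomial, compExponent, MvPolynomial.monomial_sum_one, MvPolynomial.eval_monomial]

lemma coeff_quasiMonomial_eq_zero {r p p' : ℕ} {q : Fin p → ℕ} {q' : Fin p' → ℕ}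
    {s : Fin p → Fin r} (hq : ∀ j, 0 < q j) (hq' : ∀ j, 0 < q' j) (hs : StrictMono s)
    (hne : p' ≠ p) : (quasiMonomial r q').coeff (compExponent q s) = 0 := by
  rw [quasiMonomial, MvPolynomial.coeff_sum]
  refine Finset.sum_eq_zero fun s' hs' => ?_
  rw [MvPolynomial.coeff_monomial, if_neg]
  intro h
  exact hne (length_eq_of_compExponent_eq hq' hq
    (fun i j hij => (Finset.mem_filter.1 hs').2 i j hij) hs h)

lemma coeff_quasiMonomial {r p : ℕ} {q q' : Fin p → ℕ} {s : Fin p → Fin r}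
    (hq : ∀ j, 0 < q j) (hq' : ∀ j, 0 < q' j) (hs : StrictMono s) :
    (quasiMonomial r q').coeff (compExponent q s) = if q' = q then 1 else 0 := by
  rw [quasiMonomial, MvPolynomial.coeff_sum]
  simp only [MvPolynomial.coeff_monomial]
  split_ifs with hqq
  · subst hqq
    rw [Finset.sum_eq_single s, if_pos rfl]
    · intro s' hs' hne
      refine if_neg fun h => hne ?_
      exact (eq_of_compExponent_eq hq hq
        (fun i j hij => (Finset.mem_filter.1 hs').2 i j hij) hs h).2
    · intro hmem
      exact absurd (Finset.mem_filter.2 ⟨Finset.mem_univ _, fun _ _ hij => hs hij⟩) hmem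
  · refine Finset.sum_eq_zero fun s' hs' => if_neg fun h => hqq ?_
    exact (eq_of_compExponent_eq hq' hq
      (fun i j hij => (Finset.mem_filter.1 hs').2 i j hij) hs h).1

lemma pos_of_mem_comps {m p : ℕ} {q : Fin p → ℕ} (hq : q ∈ comps m p) (j : Fin p) : 0 < q j :=
  (Finset.mem_Icc.1 (Fintype.mem_piFinset.1 (Finset.mem_filter.1 hq).1 j)).1

/-- A polynomial that vanishes at all strictly decreasing positive real points is zero. -/
lemma MvPolynomial.eq_zero_of_eval_strictAnti {r : ℕ} (P : MvPolynomial (Fin r) ℂ)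
    (hP : ∀ v : Fin r → ℝ, StrictAnti v → (∀ i, 0 < v i) →
      MvPolynomial.eval (fun i => (v i : ℂ)) P = 0) : P = 0 := by
  refine MvPolynomial.funext_set
    (fun i : Fin r => Complex.ofReal '' Set.Ioo ((r : ℝ) - i) (r - i + 1)) (fun i => ?_) ?_
  · exact (Set.Ioo_infinite (by linarith)).image Complex.ofReal_injective.injOn
  · intro y hy
    choose v hv hvy using fun i => hy i (Set.mem_univ i)
    obtain rfl : (fun i => (v i : ℂ)) = y := _root_.funext hvy
    rw [map_zero]
    refine hP v (fun i j hij => ?_) fun i => ?_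
    · have hij' : (i : ℝ) + 1 ≤ j := by exact_mod_cast hij
      have h₁ := (hv i).1
      have h₂ := (hv j).2
      linarith
    · have hi : (i : ℝ) < r := by exact_mod_cast i.2
      have h₁ := (hv i).1
      linarith

/-- Linear independence of the functions `R_q` on the domain
`{t < x₁ < ⋯ < x_r}`, indexed by compositions `q` of `m` of length `1 ≤ p ≤ r`:
if a finite linear combination vanishes at every point of the domain, then all
coefficients vanish. -/
theorem Rfun_linearIndependent (r m : ℕ) (hr : 1 ≤ r) (hm : 1 ≤ m) (t : ℝ)
    (lam : ∀ p : ℕ, (Fin p → ℕ) → ℂ)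
    (h : ∀ x : Fin r → ℝ, (StrictMono x ∧ ∀ s, t < x s) →
      ∑ p ∈ Finset.Icc 1 r, ∑ q ∈ comps m p, lam p q * Rfun r t q x = 0) :
    ∀ p ∈ Finset.Icc 1 r, ∀ q ∈ comps m p, lam p q = 0 := by
  intro p hp q hq
  have hP : ∑ p ∈ Finset.Icc 1 r, ∑ q ∈ comps m p,
      MvPolynomial.C (lam p q) * quasiMonomial r q = 0 := by
    refine MvPolynomial.eq_zero_of_eval_strictAnti _ fun v hv hpos => ?_
    have hx := h (fun i => t + (v i)⁻¹)
      ⟨fun i j hij => by have := inv_strictAnti₀ (hpos j) (hv hij); simpa using this,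
        fun i => by simpa using hpos i⟩
    simpa [Rfun, eval_quasiMonomial] using hx
  have hs : StrictMono (Fin.castLE (Finset.mem_Icc.1 hp).2) := Fin.strictMono_castLE _
  have hcoeff := congrArg
    (MvPolynomial.coeff (compExponent q (Fin.castLE (Finset.mem_Icc.1 hp).2))) hP
  simp only [MvPolynomial.coeff_sum, MvPolynomial.coeff_C_mul, MvPolynomial.coeff_zero] at hcoeff
  rw [Finset.sum_eq_single_of_mem p hp, Finset.sum_eq_single_of_mem q hq] at hcoeff
  · simpa [coeff_quasiMonomial (pos_of_mem_comps hq) (pos_of_mem_comps hq) hs] using hcoeff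
  · intro q' hq' hne
    rw [coeff_quasiMonomial (pos_of_mem_comps hq) (pos_of_mem_comps hq') hs, if_neg hne, mul_zero]
  · intro p' _ hne
    refine Finset.sum_eq_zero fun q' hq' => ?_
    rw [coeff_quasiMonomial_eq_zero (pos_of_mem_comps hq) (pos_of_mem_comps hq') hs hne, mul_zero]
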